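/- arXiv:dg-ga/9509002 — 4 statements merged into one kernel-verified Lean document; each statement's English description precedes it below -/
import Mathlib

section
/- Let n, m, p, l be natural numbers with p ≤ n + m. Let C_p denote the subspace of ℂ^{n+m} spanned by the first p standard basis vectors. Then there exists a subspace Z of ℂ^{n+m} with dim Z = n and dim(Z ⊓ C_p) = l if and only if l ≤ n, l ≤ p, and p ≤ l + m. -/
theorem exists_sub_le_finrank {V : Type*} [AddCommGroup V] [Module ℂ V] [FiniteDimensional ℂ V]
    (C : Submodule ℂ V) (k : ℕ) (hk : k ≤ Module.finrank ℂ C) :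
    ∃ A : Submodule ℂ V, A ≤ C ∧ Module.finrank ℂ A = k := by
  let b := Module.finBasis ℂ C
  have hb : LinearIndependent ℂ (fun i : Fin k => ((b (Fin.castLE hk i) : C) : V)) := by
    have h1 := b.linearIndependent.comp (Fin.castLE hk) (Fin.castLE_injective hk)
    exact h1.map' C.subtype (Submodule.ker_subtype C)
  refine ⟨Submodule.span ℂ (Set.range fun i : Fin k => ((b (Fin.castLE hk i) : C) : V)), ?_, ?_⟩
  · rw [Submodule.span_le]
    rintro _ ⟨i, rfl⟩
    exact (b (Fin.castLE hk i)).2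
  · simpa using finrank_span_eq_card hb

/-- Wong's nonvoidness conditions for the strata of Schubert varieties: for `p ≤ n + m`
and `C_p = span (e₁, …, e_p) ⊆ ℂ^{n+m}`, there exists an `n`-dimensional subspace `Z`
with `dim (Z ⊓ C_p) = l` iff `l ≤ n`, `l ≤ p` and `p ≤ l + m`. -/
theorem exists_subspace_dim_inf_eq_iff (n m p l : ℕ) (hp : p ≤ n + m)
    (C : Submodule ℂ (Fin (n + m) → ℂ))
    (hC : C = Submodule.span ℂ
      (Set.range fun i : Fin p => Pi.single (Fin.castLE hp i) (1 : ℂ))) :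
    (∃ Z : Submodule ℂ (Fin (n + m) → ℂ),
        Module.finrank ℂ Z = n ∧ Module.finrank ℂ ↥(Z ⊓ C) = l) ↔
      l ≤ n ∧ l ≤ p ∧ p ≤ l + m := by
  have hCp : Module.finrank ℂ C = p := by
    have h1 := (Pi.basisFun ℂ (Fin (n + m))).linearIndependent.comp (Fin.castLE hp)
      (Fin.castLE_injective hp)
    have h2 := finrank_span_eq_card h1
    have h3 : (⇑(Pi.basisFun ℂ (Fin (n + m))) ∘ Fin.castLE hp) =
        fun i : Fin p => Pi.single (Fin.castLE hp i) (1 : ℂ) := by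
      funext i
      exact Pi.basisFun_apply ℂ (Fin (n + m)) (Fin.castLE hp i)
    rw [h3, ← hC, Fintype.card_fin] at h2
    exact h2
  clear hC
  have hV : Module.finrank ℂ (Fin (n + m) → ℂ) = n + m := by simp
  constructor
  · rintro ⟨Z, hZ, hl⟩
    have h1 := Submodule.finrank_mono (inf_le_left : Z ⊓ C ≤ Z)
    have h2 := Submodule.finrank_mono (inf_le_right : Z ⊓ C ≤ C)
    have h3 := Submodule.finrank_sup_add_finrank_inf_eq Z C
    have h4 := Submodule.finrank_le (Z ⊔ C)
    omega
  · rintro ⟨h1, h2, h3⟩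
    obtain ⟨D, hD⟩ := Submodule.exists_isCompl C
    have h4 := Submodule.finrank_add_eq_of_isCompl hD
    obtain ⟨A, hA, hAl⟩ := exists_sub_le_finrank C l (by omega)
    obtain ⟨B, hB, hBl⟩ := exists_sub_le_finrank D (n - l) (by omega)
    have hBC : B ⊓ C = ⊥ := (hD.symm.disjoint.mono_left hB).eq_bot
    have hAB : A ⊓ B = ⊥ := (hD.disjoint.mono hA hB).eq_bot
    refine ⟨A ⊔ B, ?_, ?_⟩
    · have h5 := Submodule.finrank_sup_add_finrank_inf_eq A B
      rw [hAB, finrank_bot] at h5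
      omega
    · rw [sup_inf_assoc_of_le B hA, hBC, sup_bot_eq, hAl]
end

section
/- Let ε ∈ {1, −1}, let J be the (n+m)×(n+m) block diagonal matrix with blocks ε·1ₙ and 1ₘ, and let U be an (n+m)×(n+m) complex matrix with blocks A (n×n), B (n×m), C (m×n), D (m×m) satisfying Uᴴ·J·U = J. Let Z be an n×m complex matrix such that C·Z + D and Z·Bᴴ − ε·Aᴴ are invertible. Then (A·Z + B)·(C·Z + D)⁻¹ = (Z·Bᴴ − ε·Aᴴ)⁻¹·(Cᴴ − ε·Z·Dᴴ). -/
open Matrix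

/-- Alternate closed form of the fractional linear action on the Grassmannian: if
`U = [[A, B], [C, D]]` satisfies `Uᴴ·J·U = J` where `J = diag(ε•1ₙ, 1ₘ)`, and
`C·Z + D` and `Z·Bᴴ - ε•Aᴴ` are invertible, then
`(A·Z + B)·(C·Z + D)⁻¹ = (Z·Bᴴ - ε•Aᴴ)⁻¹·(Cᴴ - ε•Z·Dᴴ)`. -/
theorem fractional_linear_alternate_form (n m : ℕ) (ε : ℝ) (hε : ε = 1 ∨ ε = -1)
    (A : Matrix (Fin n) (Fin n) ℂ) (B : Matrix (Fin n) (Fin m) ℂ)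
    (C : Matrix (Fin m) (Fin n) ℂ) (D : Matrix (Fin m) (Fin m) ℂ)
    (J : Matrix (Fin n ⊕ Fin m) (Fin n ⊕ Fin m) ℂ)
    (hJ : J = Matrix.fromBlocks ((ε : ℂ) • (1 : Matrix (Fin n) (Fin n) ℂ)) 0 0
      (1 : Matrix (Fin m) (Fin m) ℂ))
    (hU : (Matrix.fromBlocks A B C D)ᴴ * J * Matrix.fromBlocks A B C D = J)
    (Z : Matrix (Fin n) (Fin m) ℂ)
    (h1 : IsUnit (C * Z + D))
    (h2 : IsUnit (Z * Bᴴ - (ε : ℂ) • Aᴴ)) :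
    (A * Z + B) * (C * Z + D)⁻¹ =
      (Z * Bᴴ - (ε : ℂ) • Aᴴ)⁻¹ * (Cᴴ - (ε : ℂ) • (Z * Dᴴ)) := by
  subst hJ
  rw [fromBlocks_conjTranspose, fromBlocks_multiply, fromBlocks_multiply, fromBlocks_inj] at hU
  obtain ⟨e1, e2, e3, e4⟩ := hU
  have key : (Z * Bᴴ - (ε : ℂ) • Aᴴ) * (A * Z + B) =
      (Cᴴ - (ε : ℂ) • (Z * Dᴴ)) * (C * Z + D) := by
    have f1 := congrArg (fun X => X * Z) e1
    have f3 := congrArg (fun X => Z * X * Z) e3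
    have f4 := congrArg (fun X => Z * X) e4
    rcases hε with rfl | rfl
    · simp [Matrix.mul_add, Matrix.add_mul, Matrix.sub_mul, Matrix.mul_assoc]
        at e2 f1 f3 f4 ⊢
      linear_combination (norm := skip) f3 + f4 - f1 - e2
      abel
    · simp [Matrix.mul_add, Matrix.add_mul, Matrix.mul_assoc]
        at e2 f1 f3 f4 ⊢
      linear_combination (norm := skip) -f3 - f4 - f1 - e2
      abel
  have d1 := (Matrix.isUnit_iff_isUnit_det _).mp h1
  have d2 := (Matrix.isUnit_iff_isUnit_det _).mp h2
  calc (A * Z + B) * (C * Z + D)⁻¹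
      = (Z * Bᴴ - (ε : ℂ) • Aᴴ)⁻¹ * ((Z * Bᴴ - (ε : ℂ) • Aᴴ) * (A * Z + B))
          * (C * Z + D)⁻¹ := by rw [Matrix.nonsing_inv_mul_cancel_left _ _ d2]
    _ = _ := by
      rw [key, Matrix.mul_assoc, Matrix.mul_nonsing_inv_cancel_right _ _ d1]
end

section
/- Let k ≥ 1 and let θ₁,…,θ_k be real numbers with 0 ≤ θᵢ ≤ π/2 for all i. Then arccos(∏_{i=1}^{k} cos θᵢ) ≤ √(θ₁² + … + θ_k²). Equivalently, if δ ≥ 0 satisfies δ² = θ₁² + … + θ_k² and s ∈ [0, π/2] satisfies cos s = cos θ₁ ⋯ cos θ_k, then s ≤ δ. -/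
open Real

lemma aux_sinc {x y : ℝ} (hx : 0 ≤ x) (hxy : x ≤ y) (hy : 0 < y) (hp : y ≤ π) :
    x * sin y ≤ y * sin x := by
  have hy0 : y ∈ Set.Icc 0 π := ⟨hy.le, hp⟩
  have hz0 : (0 : ℝ) ∈ Set.Icc 0 π := ⟨le_refl _, pi_pos.le⟩
  have ha : 0 ≤ x / y := by positivity
  have hb : 0 ≤ 1 - x / y := by rw [sub_nonneg, div_le_one hy]; exact hxy
  have h := strictConcaveOn_sin_Icc.concaveOn.2 hy0 hz0 ha hb (by ring)
  simp only [smul_eq_mul, sin_zero, mul_zero, add_zero] at h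
  rw [div_mul_cancel₀ _ hy.ne'] at h
  have h2 := mul_le_mul_of_nonneg_left h hy.le
  have h3 : y * (x / y * sin y) = x * sin y := by field_simp
  linarith

lemma aux_tangent {v w : ℝ} (hw : 0 < w) (hwp : w ≤ π) (hv : 0 ≤ v) (hvp : v ≤ π) :
    cos w + sin w / w / 2 * w ^ 2 ≤ cos v + sin w / w / 2 * v ^ 2 := by
  set f : ℝ → ℝ := fun x => cos x + sin w / w / 2 * x ^ 2 with hf
  have hd : ∀ x, HasDerivAt f (-sin x + sin w / w * x) x := by
    intro x
    have := (hasDerivAt_cos x).add ((hasDerivAt_pow 2 x).const_mul (sin w / w / 2))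
    refine HasDerivAt.congr_deriv this ?_
    push_cast
    ring
  have hc : Continuous f := by fun_prop
  have hdf : Differentiable ℝ f := fun x => (hd x).differentiableAt
  rcases le_total v w with h | h
  · have : AntitoneOn f (Set.Icc 0 w) := by
      apply antitoneOn_of_deriv_nonpos (convex_Icc _ _) hc.continuousOn hdf.differentiableOn
      intro x hx
      rw [interior_Icc] at hx
      rw [(hd x).deriv]
      have := aux_sinc hx.1.le hx.2.le hw hwp
      have h3 : sin w / w * x ≤ sin x := by
        rw [div_mul_eq_mul_div, div_le_iff₀ hw]; linarith
      linarith
    exact this ⟨hv, h⟩ ⟨hw.le, le_refl _⟩ h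
  · have : MonotoneOn f (Set.Icc w π) := by
      apply monotoneOn_of_deriv_nonneg (convex_Icc _ _) hc.continuousOn hdf.differentiableOn
      intro x hx
      rw [interior_Icc] at hx
      rw [(hd x).deriv]
      have := aux_sinc hw.le hx.1.le (hw.trans hx.1) hx.2.le
      have h3 : sin x ≤ sin w / w * x := by
        rw [div_mul_eq_mul_div, le_div_iff₀ hw]; linarith
      linarith
    exact this ⟨le_refl _, hwp⟩ ⟨h, hvp⟩ h

lemma aux_two {a b : ℝ} (ha : 0 ≤ a) (hb : 0 ≤ b) (h : √(a ^ 2 + b ^ 2) ≤ π / 2) :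
    cos √(a ^ 2 + b ^ 2) ≤ cos a * cos b := by
  have hsq : √(a ^ 2 + b ^ 2) ^ 2 = a ^ 2 + b ^ 2 := sq_sqrt (by positivity)
  have ha' : a ≤ √(a ^ 2 + b ^ 2) := le_sqrt_of_sq_le (by nlinarith)
  have hb' : b ≤ √(a ^ 2 + b ^ 2) := le_sqrt_of_sq_le (by nlinarith)
  generalize √(a ^ 2 + b ^ 2) = w at *
  rcases (ha.trans ha').eq_or_lt with h0 | h0
  · have h1 : a = 0 := by linarith
    have h2 : b = 0 := by linarith
    subst h1 h2
    simpa using cos_le_one w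
  · have hp := pi_pos
    have h1 := aux_tangent h0 (by linarith) (v := a + b) (by linarith) (by linarith)
    have h2 := aux_tangent h0 (by linarith) (v := |a - b|) (abs_nonneg _)
      (abs_le.2 ⟨by linarith, by linarith⟩)
    rw [cos_abs, sq_abs, cos_sub] at h2
    rw [cos_add] at h1
    rw [hsq] at h1 h2
    nlinarith

lemma aux_prod {ι : Type*} (s : Finset ι) (θ : ι → ℝ)
    (hθ0 : ∀ i, 0 ≤ θ i) (hθ : ∀ i, θ i ≤ π / 2) (h : √(∑ i ∈ s, θ i ^ 2) ≤ π / 2) :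
    cos √(∑ i ∈ s, θ i ^ 2) ≤ ∏ i ∈ s, cos (θ i) := by
  classical
  induction s using Finset.induction_on with
  | empty => simp
  | insert i s hi ih =>
    rw [Finset.sum_insert hi] at h ⊢
    rw [Finset.prod_insert hi]
    have hs : 0 ≤ ∑ i ∈ s, θ i ^ 2 := Finset.sum_nonneg fun i _ => sq_nonneg _
    have ih' := ih ((sqrt_le_sqrt (by nlinarith [sq_nonneg (θ i)])).trans h)
    have h2 := aux_two (hθ0 i) (sqrt_nonneg (∑ i ∈ s, θ i ^ 2))
    rw [sq_sqrt hs] at h2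
    refine (h2 h).trans (mul_le_mul_of_nonneg_left ih' ?_)
    exact cos_nonneg_of_neg_pi_div_two_le_of_le (by linarith [hθ0 i, pi_pos]) (hθ i)

/-- For stationary angles `θ₁, …, θ_k ∈ [0, π/2]`,
`arccos (∏ cos θᵢ) ≤ √(∑ θᵢ²)`: the geodesic distance on the Grassmann manifold
is at least the distance between the images under the Plücker embedding. -/
theorem arccos_prod_cos_le_sqrt_sum_sq (k : ℕ) (hk : 1 ≤ k) (θ : Fin k → ℝ)
    (hθ0 : ∀ i, 0 ≤ θ i) (hθ : ∀ i, θ i ≤ π / 2) :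
    Real.arccos (∏ i, Real.cos (θ i)) ≤ Real.sqrt (∑ i, θ i ^ 2) := by
  rcases le_total (√(∑ i, θ i ^ 2)) (π / 2) with h | h
  · have h1 := arccos_le_arccos (aux_prod Finset.univ θ hθ0 hθ h)
    rwa [arccos_cos (sqrt_nonneg _) (by linarith [pi_pos])] at h1
  · refine le_trans (arccos_le_pi_div_two.2 (Finset.prod_nonneg fun i _ => ?_)) h
    exact cos_nonneg_of_neg_pi_div_two_le_of_le (by linarith [hθ0 i, pi_pos]) (hθ i)
end

section
/- Let x, y be real numbers with 0 ≤ x ≤ π/2 and 0 ≤ y ≤ π/2. Then cos(√(x² + y²)) ≤ cos x · cos y. -/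
open Real

lemma aux_sinc_s17 {a b : ℝ} (ha : 0 < a) (hab : a ≤ b) (hb : b ≤ π) : sin b / b ≤ sin a / a := by
  have hb0 : 0 < b := ha.trans_le hab
  have hb1 : b ∈ Set.Icc 0 π := ⟨hb0.le, hb⟩
  have h01 : (0 : ℝ) ∈ Set.Icc 0 π := ⟨le_rfl, pi_pos.le⟩
  have hc : 0 ≤ a / b := by positivity
  have hd : 0 ≤ 1 - a / b := by rw [sub_nonneg, div_le_one hb0]; exact hab
  have h := strictConcaveOn_sin_Icc.concaveOn.2 hb1 h01 hc hd (by ring)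
  simp only [smul_eq_mul, sin_zero, mul_zero, add_zero, div_mul_cancel₀ a hb0.ne'] at h
  rw [le_div_iff₀ ha]
  calc sin b / b * a = a / b * sin b := by ring
    _ ≤ sin a := h

lemma aux_deriv {w : ℝ} (hw : 0 < w) :
    HasDerivAt (fun w => cos (√w)) (-(sin (√w) / √w) / 2) w := by
  have h := (hasDerivAt_sqrt hw.ne').cos
  convert h using 1
  have : √w ≠ 0 := (sqrt_pos.2 hw).ne'
  field_simp

lemma aux_convex : ConvexOn ℝ (Set.Icc 0 (π ^ 2)) (fun w => cos (√w)) := by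
  apply MonotoneOn.convexOn_of_deriv (convex_Icc _ _)
  · fun_prop
  · rw [interior_Icc]
    intro w hw
    exact (aux_deriv hw.1).differentiableAt.differentiableWithinAt
  · rw [interior_Icc]
    intro w hw z hz hwz
    rw [(aux_deriv hw.1).deriv, (aux_deriv hz.1).deriv]
    have := aux_sinc_s17 (sqrt_pos.2 hw.1) (sqrt_le_sqrt hwz)
      ((sqrt_le_left pi_pos.le).2 hz.2.le)
    linarith

/-- For `0 ≤ x ≤ π/2` and `0 ≤ y ≤ π/2`, `cos (√(x² + y²)) ≤ cos x * cos y`. -/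
theorem cos_sqrt_sq_add_sq_le_cos_mul_cos (x y : ℝ)
    (hx0 : 0 ≤ x) (hx : x ≤ π / 2) (hy0 : 0 ≤ y) (hy : y ≤ π / 2) :
    Real.cos (Real.sqrt (x ^ 2 + y ^ 2)) ≤ Real.cos x * Real.cos y := by
  have h1 : (x + y) ^ 2 ∈ Set.Icc 0 (π ^ 2) :=
    ⟨sq_nonneg _, by apply pow_le_pow_left₀ <;> linarith⟩
  have h2 : (x - y) ^ 2 ∈ Set.Icc 0 (π ^ 2) :=
    ⟨sq_nonneg _, by apply sq_le_sq' <;> linarith [pi_pos]⟩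
  have hh : (0 : ℝ) ≤ 1 / 2 := by norm_num
  have h := aux_convex.2 h1 h2 hh hh (by norm_num)
  simp only [smul_eq_mul, sqrt_sq_eq_abs, cos_abs, cos_add, cos_sub] at h
  rw [show 1 / 2 * (x + y) ^ 2 + 1 / 2 * (x - y) ^ 2 = x ^ 2 + y ^ 2 by ring] at h
  linarith
end
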